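/- arXiv:0806.3520 — 3 statements merged into one kernel-verified Lean document; each statement's English description precedes it below -/
import Mathlib

section
/- The four-dimensional 3-bracket defined on ℝ⁴ in the standard basis e₁,e₂,e₃,e₄ by [x,y,z]_d := Σ_{a,b,c=1}^{4} ε_{abcd} x_a y_b z_c, where ε_{abcd} is the totally antisymmetric tensor with ε_{1234} = +1, is a trilinear alternating map which satisfies the Fundamental Identity [x,y,[u,v,w]] = [[x,y,u],v,w] + [u,[x,y,v],w] + [u,v,[x,y,w]] for all x,y,u,v,w ∈ ℝ⁴. (This is the statement that 𝒜₄ is a Nambu–Lie 3-algebra.) -/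
/-- The totally antisymmetric tensor `ε_{abcd}` on four indices, with
`ε` of the identity arrangement equal to `+1`: it equals the sign of the
permutation `(a,b,c,d)` and vanishes when two indices coincide. -/
def eps4 (a b c d : Fin 4) : ℤ :=
  ∑ σ : Equiv.Perm (Fin 4),
    if σ 0 = a ∧ σ 1 = b ∧ σ 2 = c ∧ σ 3 = d then (Equiv.Perm.sign σ : ℤ) else 0

/-- The 3-bracket of the four-dimensional Nambu–Lie 3-algebra `𝒜₄` on `ℝ⁴`:
`[x,y,z]_d = Σ_{a,b,c} ε_{abcd} x_a y_b z_c`. -/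
noncomputable def bra4 (x y z : Fin 4 → ℝ) : Fin 4 → ℝ :=
  fun d => ∑ a, ∑ b, ∑ c, (eps4 a b c d : ℝ) * x a * y b * z c

theorem twelve_mul_eps4 (a b c d : Fin 4) :
    12 * eps4 a b c d = ((b : ℤ) - a) * (c - a) * (d - a) * (c - b) * (d - b) * (d - c) := by
  revert a b c d
  decide +kernel

theorem bra4_eq (x y z : Fin 4 → ℝ) (d : Fin 4) :
    bra4 x y z d = ∑ a : Fin 4, ∑ b : Fin 4, ∑ c : Fin 4,
      (((b : ℝ) - a) * (c - a) * (d - a) * (c - b) * (d - b) * (d - c)) / 12 * x a * y b * z c := by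
  have h (a b c : Fin 4) : (eps4 a b c d : ℝ) =
      (((b : ℝ) - a) * (c - a) * (d - a) * (c - b) * (d - b) * (d - c)) / 12 := by
    rw [eq_div_iff (by norm_num), mul_comm]
    exact_mod_cast twelve_mul_eps4 a b c d
  simp only [bra4, h]

/-- The bracket as the cross product of three vectors in `ℝ⁴`, written out in coordinates. -/
theorem bra4_eq_vec (x y z : Fin 4 → ℝ) :
    bra4 x y z =
      ![-(x 1 * (y 2 * z 3 - y 3 * z 2) - x 2 * (y 1 * z 3 - y 3 * z 1)
          + x 3 * (y 1 * z 2 - y 2 * z 1)),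
        x 0 * (y 2 * z 3 - y 3 * z 2) - x 2 * (y 0 * z 3 - y 3 * z 0)
          + x 3 * (y 0 * z 2 - y 2 * z 0),
        -(x 0 * (y 1 * z 3 - y 3 * z 1) - x 1 * (y 0 * z 3 - y 3 * z 0)
          + x 3 * (y 0 * z 1 - y 1 * z 0)),
        x 0 * (y 1 * z 2 - y 2 * z 1) - x 1 * (y 0 * z 2 - y 2 * z 0)
          + x 2 * (y 0 * z 1 - y 1 * z 0)] := by
  ext d
  rw [bra4_eq]
  fin_cases d <;> simp [Fin.sum_univ_four] <;> ring

/-- `𝒜₄` is a Nambu–Lie 3-algebra: `ε_{1234} = 1`, the bracket is trilinear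
and alternating, and it satisfies the Fundamental Identity. -/
theorem A4_is_nambu_lie :
    eps4 0 1 2 3 = 1 ∧
    (∀ (r : ℝ) (x x' y z : Fin 4 → ℝ),
        bra4 (r • x + x') y z = r • bra4 x y z + bra4 x' y z) ∧
    (∀ (r : ℝ) (x y y' z : Fin 4 → ℝ),
        bra4 x (r • y + y') z = r • bra4 x y z + bra4 x y' z) ∧
    (∀ (r : ℝ) (x y z z' : Fin 4 → ℝ),
        bra4 x y (r • z + z') = r • bra4 x y z + bra4 x y z') ∧
    (∀ x y : Fin 4 → ℝ, bra4 x x y = 0) ∧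
    (∀ x y : Fin 4 → ℝ, bra4 x y y = 0) ∧
    (∀ x y : Fin 4 → ℝ, bra4 x y x = 0) ∧
    (∀ x y u v w : Fin 4 → ℝ,
      bra4 x y (bra4 u v w) =
        bra4 (bra4 x y u) v w + bra4 u (bra4 x y v) w + bra4 u v (bra4 x y w)) := by
  refine ⟨?_, ?_, ?_, ?_, ?_, ?_, ?_, ?_⟩
  · have h := twelve_mul_eps4 0 1 2 3
    norm_num at h
    omega
  all_goals
    intros
    ext d
    fin_cases d <;> simp [bra4_eq_vec] <;> ring
end

section
/- Let T₁,T₂,T₃,T₄ be an n×n matrix representation of the Nambu–Lie 3-algebra 𝒜₄, and suppose T₄ = t·I is a scalar matrix with t ≠ 0. Then the first three matrices satisfy the su(2)-type commutation relations [T_i,T_j] = −i t^{−1} Σ_{k=1}^{3} ε_{ijk} T_k for all i,j ∈ {1,2,3}, where [X,Y] := XY − YX. -/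
/-- The Nambu commutator of three square complex matrices:
`[A,B,C]_N = ABC + BCA + CAB − BAC − ACB − CBA`. -/
noncomputable def nambu {n : ℕ} (A B C : Matrix (Fin n) (Fin n) ℂ) :
    Matrix (Fin n) (Fin n) ℂ :=
  A * B * C + B * C * A + C * A * B - B * A * C - A * C * B - C * B * A

/-- The totally antisymmetric tensor `ε_{ijk}` on three indices with
`ε_{123} = +1` (indices `1,2,3` are represented by `0,1,2 : Fin 3`). -/
def eps3 (i j k : Fin 3) : ℤ :=
  ∑ σ : Equiv.Perm (Fin 3),
    if σ 0 = i ∧ σ 1 = j ∧ σ 2 = k then (Equiv.Perm.sign σ : ℤ) else 0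

/-- The Nambu commutator with a scalar matrix is a multiple of the ordinary commutator. -/
theorem nambu_smul_one_right {n : ℕ} (A B : Matrix (Fin n) (Fin n) ℂ) (t : ℂ) :
    nambu A B (t • 1) = t • (A * B - B * A) := by
  simp only [nambu, mul_smul_comm, smul_mul_assoc, mul_one, one_mul, smul_sub]
  abel

theorem eps4_castSucc_three_castSucc (i j k : Fin 3) :
    eps4 i.castSucc j.castSucc 3 k.castSucc = -eps3 i j k := by
  revert i j k
  decide +kernel

theorem eps4_castSucc_three_last (i j : Fin 3) :
    eps4 i.castSucc j.castSucc 3 (Fin.last 3) = 0 := by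
  revert i j
  decide +kernel

/-- If `T₁,T₂,T₃,T₄` is an `n×n` matrix representation of the Nambu–Lie
3-algebra `𝒜₄` and `T₄ = t·I` with `t ≠ 0`, then `T₁,T₂,T₃` satisfy the
su(2)-type commutation relations `[T_i,T_j] = −i t⁻¹ Σ_k ε_{ijk} T_k`. -/
theorem A4_rep_scalar_T4_su2 (n : ℕ) (T : Fin 4 → Matrix (Fin n) (Fin n) ℂ)
    (hrep : ∀ a b c : Fin 4,
      nambu (T a) (T b) (T c) = Complex.I • ∑ d, (eps4 a b c d : ℂ) • T d)
    (t : ℂ) (ht : t ≠ 0)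
    (hT4 : T 3 = t • 1) :
    ∀ i j : Fin 3,
      T i.castSucc * T j.castSucc - T j.castSucc * T i.castSucc =
        (-Complex.I * t⁻¹) • ∑ k : Fin 3, (eps3 i j k : ℂ) • T k.castSucc := by
  intro i j
  have hcomm := hrep i.castSucc j.castSucc 3
  rw [hT4, nambu_smul_one_right, Fin.sum_univ_castSucc] at hcomm
  simp only [eps4_castSucc_three_castSucc, eps4_castSucc_three_last, Int.cast_neg, neg_smul,
    Int.cast_zero, zero_smul, add_zero, Finset.sum_neg_distrib, smul_neg] at hcomm
  rw [← inv_smul_smul₀ ht (_ - _), hcomm, smul_neg, smul_smul, ← neg_smul]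
  congr 1
  ring
end

section
/- There is no nontrivial two-dimensional Hermitian representation of 𝒜₄: if T₁,T₂,T₃,T₄ are Hermitian 2×2 complex matrices satisfying [T_a,T_b,T_c]_N = i Σ_{d=1}^{4} ε_{abcd} T_d for all a,b,c ∈ {1,2,3,4}, then T₁ = T₂ = T₃ = T₄ = 0. -/
/-- The coordinates of a Hermitian `2 × 2` matrix in the basis of the identity and the Pauli
matrices. -/
theorem Matrix.IsHermitian.exists_pauli_coordinates {A : Matrix (Fin 2) (Fin 2) ℂ}
    (hA : A.IsHermitian) :
    ∃ t x y z : ℝ, A = !![⟨t + z, 0⟩, ⟨x, -y⟩; ⟨x, y⟩, ⟨t - z, 0⟩] := by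
  have h00 := hA.apply 0 0
  have h11 := hA.apply 1 1
  have h01 := hA.apply 0 1
  simp only [Complex.star_def, Complex.ext_iff, Complex.conj_re, Complex.conj_im] at h00 h11 h01
  refine ⟨((A 0 0).re + (A 1 1).re) / 2, (A 1 0).re, (A 1 0).im,
    ((A 0 0).re - (A 1 1).re) / 2, ?_⟩
  ext i j
  fin_cases i <;> fin_cases j <;> apply Complex.ext <;> simp <;> linarith

/-- If four Hermitian `2 × 2` matrices satisfy the relations of `𝒜₄`, the last one vanishes. -/
theorem eq_zero_of_nambu_relations {A B C D : Matrix (Fin 2) (Fin 2) ℂ}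
    (hA : A.IsHermitian) (hB : B.IsHermitian) (hC : C.IsHermitian) (hD : D.IsHermitian)
    (hBCD : nambu B C D = -(Complex.I • A)) (hACD : nambu A C D = Complex.I • B)
    (hABD : nambu A B D = -(Complex.I • C)) (hABC : nambu A B C = Complex.I • D) :
    D = 0 := by
  obtain ⟨t₁, x₁, y₁, z₁, rfl⟩ := hA.exists_pauli_coordinates
  obtain ⟨t₂, x₂, y₂, z₂, rfl⟩ := hB.exists_pauli_coordinates
  obtain ⟨t₃, x₃, y₃, z₃, rfl⟩ := hC.exists_pauli_coordinates
  obtain ⟨t, x, y, z, rfl⟩ := hD.exists_pauli_coordinates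
  clear hA hB hC hD
  simp only [nambu, ← Matrix.ext_iff, Fin.forall_fin_two, Complex.ext_iff] at hBCD hACD hABD hABC
  simp at hBCD hACD hABD hABC
  obtain ⟨⟨⟨-, a₁⟩, -⟩, -, -, b₁⟩ := hBCD
  obtain ⟨⟨⟨-, a₂⟩, -⟩, -, -, b₂⟩ := hACD
  obtain ⟨⟨⟨-, a₃⟩, -⟩, ⟨c₃, d₃⟩, -, b₃⟩ := hABD
  obtain ⟨⟨⟨-, a₄⟩, -⟩, ⟨c₄, d₄⟩, -, b₄⟩ := hABC
  have h₄ : 3 * (x ^ 2 + y ^ 2 + z ^ 2) + t₁ ^ 2 + t₂ ^ 2 + t₃ ^ 2 = 0 := by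
    linear_combination t₁ / 2 * (a₁ + b₁) - t₂ / 2 * (a₂ + b₂) + t₃ / 2 * (a₃ + b₃)
      - 3 * z / 2 * (a₄ - b₄) - 3 * x * d₄ + 3 * y * c₄
  have h₃ : 3 * (x₃ ^ 2 + y₃ ^ 2 + z₃ ^ 2) + t₁ ^ 2 + t₂ ^ 2 + t ^ 2 = 0 := by
    linear_combination t₁ / 2 * (a₁ + b₁) - t₂ / 2 * (a₂ + b₂) - t / 2 * (a₄ + b₄)
      + 3 * z₃ / 2 * (a₃ - b₃) + 3 * x₃ * d₃ - 3 * y₃ * c₃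
  have hx : x = 0 := by
    apply sq_eq_zero_iff.mp
    linarith only [h₄, sq_nonneg x, sq_nonneg y, sq_nonneg z, sq_nonneg t₁, sq_nonneg t₂,
      sq_nonneg t₃]
  have hy : y = 0 := by
    apply sq_eq_zero_iff.mp
    linarith only [h₄, sq_nonneg x, sq_nonneg y, sq_nonneg z, sq_nonneg t₁, sq_nonneg t₂,
      sq_nonneg t₃]
  have hz : z = 0 := by
    apply sq_eq_zero_iff.mp
    linarith only [h₄, sq_nonneg x, sq_nonneg y, sq_nonneg z, sq_nonneg t₁, sq_nonneg t₂,
      sq_nonneg t₃]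
  have ht : t = 0 := by
    apply sq_eq_zero_iff.mp
    linarith only [h₃, sq_nonneg x₃, sq_nonneg y₃, sq_nonneg z₃, sq_nonneg t₁, sq_nonneg t₂,
      sq_nonneg t]
  subst hx hy hz ht
  ext i j
  fin_cases i <;> fin_cases j <;> apply Complex.ext <;> simp

/-- There is no nontrivial two-dimensional Hermitian representation of `𝒜₄`:
if `T₁,T₂,T₃,T₄` are Hermitian `2×2` complex matrices satisfying the `𝒜₄`
Nambu commutation relations, then they all vanish. -/
theorem A4_no_two_dim_hermitian_rep (T : Fin 4 → Matrix (Fin 2) (Fin 2) ℂ)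
    (hherm : ∀ a : Fin 4, (T a).IsHermitian)
    (hrep : ∀ a b c : Fin 4,
      nambu (T a) (T b) (T c) = Complex.I • ∑ d, (eps4 a b c d : ℂ) • T d) :
    ∀ a : Fin 4, T a = 0 := by
  have e : eps4 1 2 3 0 = -1 ∧ eps4 0 2 3 1 = 1 ∧ eps4 0 1 3 2 = -1 ∧ eps4 0 1 2 3 = 1 := by
    decide +kernel
  have z : (∀ d, d ≠ 0 → eps4 1 2 3 d = 0) ∧ (∀ d, d ≠ 1 → eps4 0 2 3 d = 0) ∧
      (∀ d, d ≠ 2 → eps4 0 1 3 d = 0) ∧ (∀ d, d ≠ 3 → eps4 0 1 2 d = 0) := by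
    decide +kernel
  obtain ⟨e₀, e₁, e₂, e₃⟩ := e
  obtain ⟨z₀, z₁, z₂, z₃⟩ := z
  have h₀ : nambu (T 1) (T 2) (T 3) = -(Complex.I • T 0) := by
    rw [hrep, Finset.sum_eq_single 0 (fun d _ hd => by simp [z₀ d hd]) (by simp), e₀]
    simp
  have h₁ : nambu (T 0) (T 2) (T 3) = Complex.I • T 1 := by
    rw [hrep, Finset.sum_eq_single 1 (fun d _ hd => by simp [z₁ d hd]) (by simp), e₁]
    simp
  have h₂ : nambu (T 0) (T 1) (T 3) = -(Complex.I • T 2) := by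
    rw [hrep, Finset.sum_eq_single 2 (fun d _ hd => by simp [z₂ d hd]) (by simp), e₂]
    simp
  have h₃ : nambu (T 0) (T 1) (T 2) = Complex.I • T 3 := by
    rw [hrep, Finset.sum_eq_single 3 (fun d _ hd => by simp [z₃ d hd]) (by simp), e₃]
    simp
  have hT₃ : T 3 = 0 :=
    eq_zero_of_nambu_relations (hherm 0) (hherm 1) (hherm 2) (hherm 3) h₀ h₁ h₂ h₃
  simp only [nambu, hT₃, mul_zero, zero_mul, add_zero, sub_zero,
    eq_comm (a := (0 : Matrix _ _ ℂ)), smul_eq_zero_iff_right Complex.I_ne_zero,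
    neg_eq_zero] at h₀ h₁ h₂
  intro a
  fin_cases a <;> assumption
end
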